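/- Let G be a connected graph and let w be the vector whose coordinate at each vertex u is √(d_u), where d_u is the degree of u. If w is an eigenvector of Q, then G is regular. -/

import Mathlib

open Matrix

/-- Let `G` be a connected graph and let `w` be the vector whose coordinate at
each vertex `u` is `√(d_u)`.  If `w` is an eigenvector of `Q`, then `G` is
regular. -/
theorem regular_of_sqrt_degree_eigenvector_signless
    {V : Type*} [Fintype V] [DecidableEq V]
    (G : SimpleGraph V) [DecidableRel G.Adj] (hconn : G.Connected)
    (A D Q : Matrix V V ℝ)
    (hA : A = G.adjMatrix ℝ)
    (hD : D = Matrix.diagonal fun v => (G.degree v : ℝ))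
    (hQ : Q = D + A)
    (w : V → ℝ) (hw : w = fun u => Real.sqrt (G.degree u))
    (heig : ∃ μ : ℝ, Q.mulVec w = μ • w) :
    ∃ d : ℕ, G.IsRegularOfDegree d := by
  obtain ⟨μ, hμ⟩ := heig
  have hne : Nonempty V := hconn.nonempty
  have key : ∀ u, (G.degree u : ℝ) * √(G.degree u : ℝ) +
      ∑ v ∈ G.neighborFinset u, √(G.degree v : ℝ) = μ * √(G.degree u : ℝ) := by
    intro u
    have h := congrFun hμ u
    rw [hQ, hA, hD, hw, Matrix.add_mulVec] at h
    simpa [Matrix.mulVec_diagonal, SimpleGraph.adjMatrix_mulVec_apply] using h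
  obtain ⟨u, hu⟩ := Finite.exists_max (fun v => G.degree v)
  obtain ⟨v, hv⟩ := Finite.exists_min (fun v => G.degree v)
  suffices h : G.degree u ≤ G.degree v from
    ⟨G.degree v, fun x => le_antisymm ((hu x).trans h) (hv x)⟩
  rcases subsingleton_or_nontrivial V with hs | hs
  · rw [Subsingleton.elim u v]
  have hpos : 0 < G.degree v := hconn.preconnected.degree_pos_of_nontrivial v
  have hpos' : (0 : ℝ) < G.degree v := by exact_mod_cast hpos
  have hposu : (0 : ℝ) < G.degree u := by exact_mod_cast hpos.trans_le (hv u)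
  have h1 : (G.degree u : ℝ) * √(G.degree v : ℝ) ≤
      ∑ x ∈ G.neighborFinset u, √(G.degree x : ℝ) := by
    have := Finset.card_nsmul_le_sum (G.neighborFinset u) (fun x => √(G.degree x : ℝ))
      (√(G.degree v : ℝ)) (fun x _ => Real.sqrt_le_sqrt (by exact_mod_cast hv x))
    simpa using this
  have h2 : ∑ x ∈ G.neighborFinset v, √(G.degree x : ℝ) ≤
      (G.degree v : ℝ) * √(G.degree u : ℝ) := by
    have := Finset.sum_le_card_nsmul (G.neighborFinset v) (fun x => √(G.degree x : ℝ))
      (√(G.degree u : ℝ)) (fun x _ => Real.sqrt_le_sqrt (by exact_mod_cast hu x))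
    simpa using this
  have ku := key u
  have kv := key v
  have su := Real.mul_self_sqrt hposu.le
  have sv := Real.mul_self_sqrt hpos'.le
  have pu := Real.sqrt_pos.2 hposu
  have pv := Real.sqrt_pos.2 hpos'
  have : (G.degree u : ℝ) ≤ G.degree v := by
    generalize ha : √(G.degree u : ℝ) = a at *
    generalize hb : √(G.degree v : ℝ) = b at *
    have e1 : a * a + a * b ≤ μ := by
      refine le_of_mul_le_mul_right ?_ pu
      rw [← su] at ku h1
      nlinarith
    have e2 : μ ≤ b * b + a * b := by
      refine le_of_mul_le_mul_right ?_ pv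
      rw [← sv] at kv h2
      nlinarith
    linarith
  exact_mod_cast this
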